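/- Let Ā be a unital dendriform algebra and a', b' ∈ A. Let A and B in Ā[[λ]] be solutions of the degree (1,0) equations A = 1 + λ A ≻ a' and B = 1 + λ B ≻ b', with *-inverses A⁻¹ and B⁻¹. For such an invertible solution Z define Θ_Z(x) := Z ≻ x ≺ Z⁻¹ for x ∈ A[[λ]]. Then (1) Θ_A ∘ Θ_B (x) = Θ_{A*B}(x) for all x, and (2) Θ_A ∘ Θ_{A⁻¹}(x) = Θ_{A⁻¹} ∘ Θ_A(x) = x for all x. -/

import Mathlib

open Finset

section DendriformAug

variable {k : Type} [Field k] [CharZero k]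
variable {D : Type} [AddCommGroup D] [Module k D]

/-- Elements of `Ā[[λ]]`, the power series over the augmentation `Ā = k·1 ⊕ D` of a
dendriform algebra `D` by a unit `1`, represented as a pair consisting of the
scalar-part series and the `D`-part series. -/
abbrev Aug (k D : Type) : Type := (ℕ → k) × (ℕ → D)

/-- The unit `1` of `Ā[[λ]]`. -/
def augOne : Aug k D := (fun n => if n = 0 then 1 else 0, 0)

/-- The embedding of `D` into `Ā[[λ]]` as constant series. -/
def ofD (a : D) : Aug k D := (0, fun n => if n = 0 then a else 0)

/-- Multiplication by the formal parameter `λ` on `Ā[[λ]]`. -/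
def lam (x : Aug k D) : Aug k D :=
  (fun n => match n with | 0 => 0 | Nat.succ m => x.1 m,
   fun n => match n with | 0 => 0 | Nat.succ m => x.2 m)

variable (p s : D →ₗ[k] D →ₗ[k] D)

/-- Cauchy convolution of two `D`-valued series along a bilinear operation on `D`. -/
def conv (b : D →ₗ[k] D →ₗ[k] D) (f g : ℕ → D) : ℕ → D :=
  fun n => ∑ ij ∈ antidiagonal n, b (f ij.1) (g ij.2)

/-- Cauchy convolution of a scalar series with a `D`-valued series. -/
def sconv (t : ℕ → k) (f : ℕ → D) : ℕ → D :=
  fun n => ∑ ij ∈ antidiagonal n, t ij.1 • f ij.2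

/-- Cauchy convolution of two scalar series. -/
def kconv (u t : ℕ → k) : ℕ → k :=
  fun n => ∑ ij ∈ antidiagonal n, u ij.1 * t ij.2

/-- The left dendriform product `≺` on `Ā[[λ]]`, extending `p : D → D → D`
λ-adically, with `1 ≺ a = 0` and `a ≺ 1 = a` for `a ∈ D[[λ]]`
(`1 ≺ 1` being left undefined, no scalar part is produced). -/
def precA (x y : Aug k D) : Aug k D :=
  (0, conv p x.2 y.2 + sconv y.1 x.2)

/-- The right dendriform product `≻` on `Ā[[λ]]`, extending `s : D → D → D`
λ-adically, with `1 ≻ a = a` and `a ≻ 1 = 0` for `a ∈ D[[λ]]`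
(`1 ≻ 1` being left undefined, no scalar part is produced). -/
def succA (x y : Aug k D) : Aug k D :=
  (0, conv s x.2 y.2 + sconv x.1 y.2)

/-- The associative product `x * y = x ≺ y + x ≻ y` on `Ā[[λ]]`, for which the
unit satisfies `a * 1 = 1 * a = a` and `1 * 1 = 1`. -/
def starA (x y : Aug k D) : Aug k D :=
  (kconv x.1 y.1,
   conv p x.2 y.2 + conv s x.2 y.2 + sconv y.1 x.2 + sconv x.1 y.2)

/-- The group action `Θ_Z(x) := Z ≻ x ≺ Z⁻¹` associated with an invertible `Z`
(given with its `*`-inverse `Zi`). -/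
def theta (Z Zi x : Aug k D) : Aug k D := precA p (succA s Z x) Zi

/-- The left product on `k × D` whose Cauchy convolution is `precA`. -/
def precPair : (k × D) →ₗ[k] (k × D) →ₗ[k] (k × D) :=
  LinearMap.mk₂ k (fun x y => (0, p x.2 y.2 + y.1 • x.2))
    (by intros; ext <;> simp; module) (by intros; ext <;> simp; module)
    (by intros; ext <;> simp; module) (by intros; ext <;> simp; module)

/-- The right product on `k × D` whose Cauchy convolution is `succA`. -/
def succPair : (k × D) →ₗ[k] (k × D) →ₗ[k] (k × D) :=
  LinearMap.mk₂ k (fun x y => (0, s x.2 y.2 + x.1 • y.2))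
    (by intros; ext <;> simp; module) (by intros; ext <;> simp; module)
    (by intros; ext <;> simp; module) (by intros; ext <;> simp; module)

/-- The associative product on `k × D` whose Cauchy convolution is `starA`. -/
def starPair : (k × D) →ₗ[k] (k × D) →ₗ[k] (k × D) :=
  LinearMap.mk₂ k
    (fun x y => (x.1 * y.1, p x.2 y.2 + s x.2 y.2 + y.1 • x.2 + x.1 • y.2))
    (by intros; ext <;> simp; · ring
        · module)
    (by intros; ext <;> simp; · ring
        · module)
    (by intros; ext <;> simp; · ring
        · module)
    (by intros; ext <;> simp; · ring
        · module)

/-- The coefficients of an element of `Ā[[λ]]`. -/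
def augCoeff (x : Aug k D) : ℕ → k × D := fun n => (x.1 n, x.2 n)

theorem augCoeff_injective : Function.Injective (augCoeff : Aug k D → ℕ → k × D) := by
  intro x y h
  have h' : ∀ n, x.1 n = y.1 n ∧ x.2 n = y.2 n := fun n => Prod.ext_iff.mp (congrFun h n)
  exact Prod.ext (funext fun n => (h' n).1) (funext fun n => (h' n).2)

theorem sconv_eq_sum_swap (t : ℕ → k) (f : ℕ → D) (n : ℕ) :
    sconv t f n = ∑ ij ∈ antidiagonal n, t ij.2 • f ij.1 :=
  (Finset.Nat.sum_antidiagonal_swap (f := fun ij : ℕ × ℕ => t ij.1 • f ij.2)).symm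

theorem augCoeff_precA (x y : Aug k D) :
    augCoeff (precA p x y) = conv (precPair p) (augCoeff x) (augCoeff y) := by
  funext n
  ext
  · simp [augCoeff, precA, conv, precPair, Prod.fst_sum]
  · simp [augCoeff, precA, conv, precPair, Prod.snd_sum, sum_add_distrib, sconv_eq_sum_swap]

theorem augCoeff_succA (x y : Aug k D) :
    augCoeff (succA s x y) = conv (succPair s) (augCoeff x) (augCoeff y) := by
  funext n
  ext
  · simp [augCoeff, succA, conv, succPair, Prod.fst_sum]
  · simp [augCoeff, succA, conv, succPair, Prod.snd_sum, sum_add_distrib, sconv]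

theorem augCoeff_starA (x y : Aug k D) :
    augCoeff (starA p s x y) = conv (starPair p s) (augCoeff x) (augCoeff y) := by
  funext n
  ext
  · simp [augCoeff, starA, conv, kconv, starPair, Prod.fst_sum]
  · simp only [augCoeff, starA, Pi.add_apply, sconv_eq_sum_swap y.1 x.2]
    simp [augCoeff, conv, sconv, starPair, Prod.snd_sum, sum_add_distrib]

theorem conv_assoc {b₁ b₂ b₃ b₄ : D →ₗ[k] D →ₗ[k] D}
    (h : ∀ x y z, b₁ (b₂ x y) z = b₃ x (b₄ y z)) (f g e : ℕ → D) :
    conv b₁ (conv b₂ f g) e = conv b₃ f (conv b₄ g e) := by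
  funext n
  simp only [conv, map_sum, LinearMap.sum_apply, h]
  rw [sum_sigma', sum_sigma']
  refine sum_nbij' (fun q => ⟨(q.2.1, q.2.2 + q.1.2), (q.2.2, q.1.2)⟩)
    (fun q => ⟨(q.1.1 + q.2.1, q.2.2), (q.1.1, q.2.1)⟩) ?_ ?_ ?_ ?_ ?_
  all_goals
    rintro ⟨⟨i, j⟩, ⟨i', j'⟩⟩ hq
    simp only [mem_sigma, HasAntidiagonal.mem_antidiagonal] at hq
    obtain ⟨rfl, rfl⟩ := hq
    simp [add_assoc]

variable {p s}

theorem precA_precA (ax1 : ∀ a b c : D, p (p a b) c = p a (p b c + s b c)) (x y z : Aug k D) :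
    precA p (precA p x y) z = precA p x (starA p s y z) := by
  apply augCoeff_injective
  simp only [augCoeff_precA, augCoeff_starA]
  refine conv_assoc (fun x y z => ?_) _ _ _
  ext
  · simp [precPair, starPair]
  · simp [precPair, starPair, ax1]
    module

theorem precA_succA (ax2 : ∀ a b c : D, p (s a b) c = s a (p b c)) (x y z : Aug k D) :
    precA p (succA s x y) z = succA s x (precA p y z) := by
  apply augCoeff_injective
  simp only [augCoeff_precA, augCoeff_succA]
  refine conv_assoc (fun x y z => ?_) _ _ _
  ext
  · simp [precPair, succPair]
  · simp [precPair, succPair, ax2]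
    module

theorem succA_succA (ax3 : ∀ a b c : D, s a (s b c) = s (p a b + s a b) c) (x y z : Aug k D) :
    succA s x (succA s y z) = succA s (starA p s x y) z := by
  apply augCoeff_injective
  simp only [augCoeff_succA, augCoeff_starA]
  refine (conv_assoc (fun x y z => ?_) _ _ _).symm
  ext
  · simp [succPair, starPair]
  · simp [succPair, starPair, ax3]
    module

theorem starA_assoc
    (ax1 : ∀ a b c : D, p (p a b) c = p a (p b c + s b c))
    (ax2 : ∀ a b c : D, p (s a b) c = s a (p b c))
    (ax3 : ∀ a b c : D, s a (s b c) = s (p a b + s a b) c) (x y z : Aug k D) :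
    starA p s (starA p s x y) z = starA p s x (starA p s y z) := by
  apply augCoeff_injective
  simp only [augCoeff_starA]
  refine conv_assoc (fun x y z => ?_) _ _ _
  ext
  · simp [starPair, mul_assoc]
  · simp [starPair, ax1, ax2, ax3]
    module

theorem sconv_one (f : ℕ → D) : sconv (augOne : Aug k D).1 f = f := by
  funext n
  rw [sconv, sum_eq_single (0, n)]
  · simp [augOne]
  · rintro ⟨i, j⟩ hij hne
    have : i ≠ 0 := by
      rintro rfl
      simp_all
    simp [augOne, this]
  · simp

theorem kconv_one_left (t : ℕ → k) : kconv (augOne : Aug k D).1 t = t :=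
  show sconv (augOne : Aug k k).1 t = t from sconv_one t

theorem kconv_comm (t u : ℕ → k) : kconv t u = kconv u t := by
  funext n
  exact (sconv_eq_sum_swap t u n).trans (sum_congr rfl fun _ _ => mul_comm _ _)

theorem conv_zero_left (b : D →ₗ[k] D →ₗ[k] D) (f : ℕ → D) : conv b 0 f = 0 := by
  funext n
  simp [conv]

theorem conv_zero_right (b : D →ₗ[k] D →ₗ[k] D) (f : ℕ → D) : conv b f 0 = 0 := by
  funext n
  simp [conv]

theorem sconv_zero (t : ℕ → k) : sconv t (0 : ℕ → D) = 0 := by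
  funext n
  simp [sconv]

theorem augOne_snd : (augOne : Aug k D).2 = 0 := rfl

theorem starA_one (x : Aug k D) : starA p s x augOne = x := by
  ext1
  · exact (kconv_comm _ _).trans (kconv_one_left (D := D) _)
  · simp [starA, augOne_snd, conv_zero_right, sconv_one, sconv_zero]

theorem one_starA (x : Aug k D) : starA p s augOne x = x := by
  ext1
  · exact kconv_one_left (D := D) _
  · simp [starA, augOne_snd, conv_zero_left, sconv_one, sconv_zero]

theorem theta_one {x : Aug k D} (hx : x.1 = 0) : theta p s augOne augOne x = x := by
  ext1
  · exact hx.symm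
  · simp [theta, precA, succA, augOne_snd, conv_zero_left, conv_zero_right, sconv_one]

theorem theta_theta
    (ax1 : ∀ a b c : D, p (p a b) c = p a (p b c + s b c))
    (ax2 : ∀ a b c : D, p (s a b) c = s a (p b c))
    (ax3 : ∀ a b c : D, s a (s b c) = s (p a b + s a b) c) (Y Y' Z Z' x : Aug k D) :
    theta p s Y Y' (theta p s Z Z' x) = theta p s (starA p s Y Z) (starA p s Z' Y') x := by
  simp only [theta]
  rw [← precA_precA ax1, ← succA_succA ax3, precA_succA ax2 Y (succA s Z x) Z']

variable (p s)

/-- Let `Ā` be a unital dendriform algebra, `a' b' ∈ A`, and `A₀, B₀ ∈ Ā[[λ]]`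
solutions of `A₀ = 1 + λ A₀ ≻ a'` and `B₀ = 1 + λ B₀ ≻ b'` with `*`-inverses `Ai`,
`Bi`.  With `Θ_Z(x) := Z ≻ x ≺ Z⁻¹`, for every `x ∈ A[[λ]]`:
(1) `Θ_{A₀} ∘ Θ_{B₀} (x) = Θ_{A₀*B₀}(x)` (`ABi` being the `*`-inverse of `A₀*B₀`);
(2) `Θ_{A₀} ∘ Θ_{A₀⁻¹}(x) = Θ_{A₀⁻¹} ∘ Θ_{A₀}(x) = x`. -/
theorem dendriform_theta_group_action
    (ax1 : ∀ a b c : D, p (p a b) c = p a (p b c + s b c))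
    (ax2 : ∀ a b c : D, p (s a b) c = s a (p b c))
    (ax3 : ∀ a b c : D, s a (s b c) = s (p a b + s a b) c)
    (a' b' : D) (A₀ Ai B₀ Bi ABi : Aug k D)
    (hA : A₀ = augOne + lam (succA s A₀ (ofD a')))
    (hAinv : starA p s A₀ Ai = augOne ∧ starA p s Ai A₀ = augOne)
    (hB : B₀ = augOne + lam (succA s B₀ (ofD b')))
    (hBinv : starA p s B₀ Bi = augOne ∧ starA p s Bi B₀ = augOne)
    (hABinv : starA p s (starA p s A₀ B₀) ABi = augOne ∧
      starA p s ABi (starA p s A₀ B₀) = augOne)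
    (x : Aug k D) (hx : x.1 = 0) :
    theta p s A₀ Ai (theta p s B₀ Bi x) = theta p s (starA p s A₀ B₀) ABi x ∧
    theta p s A₀ Ai (theta p s Ai A₀ x) = x ∧
    theta p s Ai A₀ (theta p s A₀ Ai x) = x := by
  have hinv : starA p s Bi Ai = ABi := by
    have assoc := starA_assoc ax1 ax2 ax3
    calc starA p s Bi Ai
        = starA p s (starA p s Bi Ai) (starA p s (starA p s A₀ B₀) ABi) := by
          rw [hABinv.1, starA_one]
      _ = starA p s (starA p s Bi (starA p s (starA p s Ai A₀) B₀)) ABi := by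
          simp only [assoc]
      _ = ABi := by rw [hAinv.2, one_starA, hBinv.2, one_starA]
  refine ⟨?_, ?_, ?_⟩
  · rw [theta_theta ax1 ax2 ax3, hinv]
  · rw [theta_theta ax1 ax2 ax3, hAinv.1, theta_one hx]
  · rw [theta_theta ax1 ax2 ax3, hAinv.2, theta_one hx]

end DendriformAug
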